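/- arXiv:1808.06665 — 3 statements merged into one kernel-verified Lean document; each statement's English description precedes it below -/
import Mathlib

section
/- Let q be an odd prime power with q ≡ 3 (mod 4) and let F be the finite field with q elements. Then every matrix A in Mat₂(F) can be written as a sum of exactly six orthogonal matrices, i.e. there exist B₁, ..., B₆ ∈ Mat₂(F) with Bᵢᵀ·Bᵢ = I for each i and A = B₁ + ... + B₆. -/
open Matrix

section UnitCircle

variable {F : Type*} [Field F]

theorem sq_add_sq_ne_zero_of_not_isSquare_neg_one (h : ¬ IsSquare (-1 : F)) {x y : F}
    (hxy : x ≠ 0 ∨ y ≠ 0) : x ^ 2 + y ^ 2 ≠ 0 := by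
  intro h0
  by_cases hy : y = 0
  · subst hy
    simp_all
  · refine h ⟨x / y, ?_⟩
    field_simp
    linear_combination -h0

theorem two_ne_zero_of_not_isSquare_neg_one (h : ¬ IsSquare (-1 : F)) : (2 : F) ≠ 0 :=
  fun h2 => h ⟨1, by linear_combination -h2⟩

/-- The points of the unit circle `a² + b² = 1` over a finite field. -/
def unitCircle (F : Type*) [Field F] [Fintype F] [DecidableEq F] : Finset (F × F) :=
  Finset.univ.filter fun p => p.1 ^ 2 + p.2 ^ 2 = 1

theorem mem_unitCircle [Fintype F] [DecidableEq F] {p : F × F} :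
    p ∈ unitCircle F ↔ p.1 ^ 2 + p.2 ^ 2 = 1 := by
  simp [unitCircle]

theorem card_add_one_le_card_unitCircle [Fintype F] [DecidableEq F] (h : ¬ IsSquare (-1 : F)) :
    Fintype.card F + 1 ≤ (unitCircle F).card := by
  have h2 := two_ne_zero_of_not_isSquare_neg_one h
  have hs (s : F) : 1 + s ^ 2 ≠ 0 := by
    simpa using sq_add_sq_ne_zero_of_not_isSquare_neg_one h (x := 1) (y := s) (by simp)
  let φ : Option F → F × F := fun o =>
    o.elim (-1, 0) fun s => ((1 - s ^ 2) / (1 + s ^ 2), 2 * s / (1 + s ^ 2))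
  have hfst (s : F) : (1 - s ^ 2) / (1 + s ^ 2) ≠ -1 := by
    intro e
    rw [div_eq_iff (hs s)] at e
    exact h2 (by linear_combination e)
  have hφ : Function.Injective φ := by
    rintro (_ | s) (_ | t) e
    · rfl
    · exact absurd (congrArg Prod.fst e).symm (hfst t)
    · exact absurd (congrArg Prod.fst e) (hfst s)
    · have e1 : (1 - s ^ 2) / (1 + s ^ 2) = (1 - t ^ 2) / (1 + t ^ 2) := congrArg Prod.fst e
      have e2 : 2 * s / (1 + s ^ 2) = 2 * t / (1 + t ^ 2) := congrArg Prod.snd e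
      rw [div_eq_div_iff (hs s) (hs t)] at e1 e2
      have hsq : s ^ 2 = t ^ 2 := mul_left_cancel₀ h2 (by linear_combination -e1)
      rw [hsq] at e2
      exact congrArg some (mul_left_cancel₀ h2 (mul_right_cancel₀ (hs t) e2))
  rw [← Fintype.card_option, ← Finset.card_univ]
  refine Finset.card_le_card_of_injOn φ ?_ hφ.injOn
  rintro (_ | s) -
  · simp [φ, unitCircle]
  · have := hs s
    simp only [φ, Finset.mem_coe, mem_unitCircle, Option.elim]
    field_simp
    ring

theorem card_unitCircle_inter_line_le_two [Fintype F] [DecidableEq F] {x y : F}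
    (hm : x ^ 2 + y ^ 2 ≠ 0) (c : F) :
    ((unitCircle F).filter fun p => x * p.1 + y * p.2 = c).card ≤ 2 := by
  by_contra! hlt
  obtain ⟨p, hp, q, hq, r, hr, hpq, hpr, hqr⟩ := Finset.two_lt_card.1 hlt
  simp only [Finset.mem_filter, mem_unitCircle] at hp hq hr
  have key {p q : F × F} (hp : x * p.1 + y * p.2 = c) (hq : x * q.1 + y * q.2 = c)
      (e : x * p.2 - y * p.1 = x * q.2 - y * q.1) : p = q := by
    refine Prod.ext (mul_left_cancel₀ hm ?_) (mul_left_cancel₀ hm ?_)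
    · linear_combination x * hp - x * hq - y * e
    · linear_combination y * hp - y * hq + x * e
  have hsq {p : F × F} (hp : p.1 ^ 2 + p.2 ^ 2 = 1 ∧ x * p.1 + y * p.2 = c) :
      (x * p.2 - y * p.1) ^ 2 = x ^ 2 + y ^ 2 - c ^ 2 := by
    rw [← hp.2]
    linear_combination (x ^ 2 + y ^ 2) * hp.1
  have h1 := (sq_eq_sq_iff_eq_or_eq_neg.1 ((hsq hp).trans (hsq hq).symm)).resolve_left
    fun e => hpq (key hp.2 hq.2 e)
  have h2 := (sq_eq_sq_iff_eq_or_eq_neg.1 ((hsq hp).trans (hsq hr).symm)).resolve_left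
    fun e => hpr (key hp.2 hr.2 e)
  exact hqr (key hq.2 hr.2 (neg_injective (h1.symm.trans h2)))

theorem card_add_one_le_two_mul_card_image_linear [Fintype F] [DecidableEq F]
    (h : ¬ IsSquare (-1 : F)) {x y : F} (hxy : x ≠ 0 ∨ y ≠ 0) :
    Fintype.card F + 1 ≤
      2 * ((unitCircle F).image fun p => x * p.1 + y * p.2).card :=
  (card_add_one_le_card_unitCircle h).trans <|
    Finset.card_le_mul_card_image _ 2 fun c _ =>
      card_unitCircle_inter_line_le_two (sq_add_sq_ne_zero_of_not_isSquare_neg_one h hxy) c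

/-- A vector whose norm is that of `(1, 0) + u`, with `u` on the unit circle, is a sum of two
points of the unit circle. -/
theorem exists_eq_add_of_norm_eq (h : ¬ IsSquare (-1 : F)) {x y a b : F}
    (hab : a ^ 2 + b ^ 2 = 1) (hn : x ^ 2 + y ^ 2 = 2 + 2 * a) :
    ∃ p q : F × F, p.1 ^ 2 + p.2 ^ 2 = 1 ∧ q.1 ^ 2 + q.2 ^ 2 = 1 ∧ (x, y) = p + q := by
  by_cases hxy : x ≠ 0 ∨ y ≠ 0
  · have hm : 2 + 2 * a ≠ 0 := hn ▸ sq_add_sq_ne_zero_of_not_isSquare_neg_one h hxy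
    -- `(c, d)` is the quotient of `x + iy` by `(1 + a) + ib`
    obtain ⟨c, hc⟩ : ∃ c, (2 + 2 * a) * c = x * (1 + a) + y * b :=
      ⟨_, mul_div_cancel₀ _ hm⟩
    obtain ⟨d, hd⟩ : ∃ d, (2 + 2 * a) * d = y * (1 + a) - x * b :=
      ⟨_, mul_div_cancel₀ _ hm⟩
    have hcd : c ^ 2 + d ^ 2 = 1 := by
      refine mul_left_cancel₀ (pow_ne_zero 2 hm) ?_
      calc (2 + 2 * a) ^ 2 * (c ^ 2 + d ^ 2)
          = ((2 + 2 * a) * c) ^ 2 + ((2 + 2 * a) * d) ^ 2 := by ring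
        _ = (2 + 2 * a) ^ 2 * 1 := by
          rw [hc, hd]
          linear_combination ((1 + a) ^ 2 + b ^ 2) * hn + (2 + 2 * a) * hab
    refine ⟨(c, d), (c * a - d * b, c * b + d * a), hcd, ?_, ?_⟩
    · linear_combination (a ^ 2 + b ^ 2) * hcd + hab
    · refine Prod.ext (mul_left_cancel₀ hm ?_) (mul_left_cancel₀ hm ?_)
      · simp only [Prod.fst_add]
        linear_combination -(1 + a) * hc + b * hd - x * hab
      · simp only [Prod.snd_add]
        linear_combination -(1 + a) * hd - b * hc - y * hab
  · push Not at hxy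
    exact ⟨(1, 0), (-1, 0), by simp, by simp, by simp [hxy]⟩

theorem exists_eq_add_add_of_ne_zero [Fintype F] (h : ¬ IsSquare (-1 : F)) {z : F × F}
    (hz : z ≠ 0) :
    ∃ p q r : F × F, p.1 ^ 2 + p.2 ^ 2 = 1 ∧ q.1 ^ 2 + q.2 ^ 2 = 1 ∧ r.1 ^ 2 + r.2 ^ 2 = 1 ∧
      z = p + q + r := by
  classical
  obtain ⟨x, y⟩ := z
  have h2 := two_ne_zero_of_not_isSquare_neg_one h
  have hxy : 2 * x ≠ 0 ∨ 2 * y ≠ 0 := by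
    by_contra! hc
    simp_all
  let s := (unitCircle F).image fun p => 2 * x * p.1 + 2 * y * p.2
  let t := (unitCircle F).image fun p => 2 * p.1 + 0 * p.2
  have hs : Fintype.card F + 1 ≤ 2 * s.card := card_add_one_le_two_mul_card_image_linear h hxy
  have ht : Fintype.card F + 1 ≤ 2 * t.card :=
    card_add_one_le_two_mul_card_image_linear h (.inl h2)
  have ht' : (t.image fun n => x ^ 2 + y ^ 2 - 1 - n).card = t.card :=
    Finset.card_image_of_injective _ sub_right_injective
  obtain ⟨c, hc⟩ : (s ∩ t.image fun n => x ^ 2 + y ^ 2 - 1 - n).Nonempty := by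
    refine Finset.inter_nonempty_of_card_lt_card_add_card
      (Finset.subset_univ _) (Finset.subset_univ _) ?_
    rw [Finset.card_univ]
    omega
  simp only [s, t, Finset.mem_inter, Finset.mem_image, mem_unitCircle] at hc
  obtain ⟨⟨u, hu, rfl⟩, _, ⟨v, hv, rfl⟩, e⟩ := hc
  obtain ⟨p, q, hp, hq, hpq⟩ := exists_eq_add_of_norm_eq h (x := x - u.1) (y := y - u.2) hv
    (by linear_combination hu + e)
  refine ⟨p, q, u, hp, hq, hu, ?_⟩
  rw [← hpq]
  ext <;> simp

theorem exists_eq_add_add_add [Fintype F] (h : ¬ IsSquare (-1 : F)) (z : F × F) :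
    ∃ p q r s : F × F, p.1 ^ 2 + p.2 ^ 2 = 1 ∧ q.1 ^ 2 + q.2 ^ 2 = 1 ∧
      r.1 ^ 2 + r.2 ^ 2 = 1 ∧ s.1 ^ 2 + s.2 ^ 2 = 1 ∧ z = p + q + r + s := by
  obtain ⟨s, hs, hzs⟩ : ∃ s : F × F, s.1 ^ 2 + s.2 ^ 2 = 1 ∧ z - s ≠ 0 := by
    by_cases hz : z = (1, 0)
    · refine ⟨(-1, 0), by simp, fun e => two_ne_zero_of_not_isSquare_neg_one h ?_⟩
      have := congrArg Prod.fst e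
      simp only [hz, Prod.fst_sub, Prod.fst_zero] at this
      linear_combination this
    · exact ⟨(1, 0), by simp, sub_ne_zero.2 hz⟩
  obtain ⟨p, q, r, hp, hq, hr, e⟩ := exists_eq_add_add_of_ne_zero h hzs
  exact ⟨p, q, r, s, hp, hq, hr, hs, by rw [← e, sub_add_cancel]⟩

end UnitCircle

section PlaneMatrices

variable {F : Type*} [Field F]

/-- The matrix of multiplication by `p.1 + i p.2`. -/
def rotationMatrix (p : F × F) : Matrix (Fin 2) (Fin 2) F := !![p.1, -p.2; p.2, p.1]

/-- The matrix of conjugation followed by multiplication by `p.1 + i p.2`. -/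
def reflectionMatrix (p : F × F) : Matrix (Fin 2) (Fin 2) F := !![p.1, p.2; p.2, -p.1]

theorem rotationMatrix_add (p q : F × F) :
    rotationMatrix (p + q) = rotationMatrix p + rotationMatrix q := by
  ext i j
  fin_cases i <;> fin_cases j <;> simp [rotationMatrix, add_comm]

theorem reflectionMatrix_add (p q : F × F) :
    reflectionMatrix (p + q) = reflectionMatrix p + reflectionMatrix q := by
  ext i j
  fin_cases i <;> fin_cases j <;> simp [reflectionMatrix, add_comm]

theorem rotationMatrix_transpose_mul_self {p : F × F} (hp : p.1 ^ 2 + p.2 ^ 2 = 1) :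
    (rotationMatrix p)ᵀ * rotationMatrix p = 1 := by
  ext i j
  fin_cases i <;> fin_cases j <;>
    simp [rotationMatrix, Matrix.mul_apply, Fin.sum_univ_two] <;>
    first | ring1 | linear_combination hp

theorem reflectionMatrix_transpose_mul_self {p : F × F} (hp : p.1 ^ 2 + p.2 ^ 2 = 1) :
    (reflectionMatrix p)ᵀ * reflectionMatrix p = 1 := by
  ext i j
  fin_cases i <;> fin_cases j <;>
    simp [reflectionMatrix, Matrix.mul_apply, Fin.sum_univ_two] <;>
    first | ring1 | linear_combination hp

theorem exists_eq_rotationMatrix_add_reflectionMatrix (h2 : (2 : F) ≠ 0)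
    (A : Matrix (Fin 2) (Fin 2) F) :
    ∃ z w : F × F, A = rotationMatrix z + reflectionMatrix w := by
  refine ⟨((A 0 0 + A 1 1) / 2, (A 1 0 - A 0 1) / 2),
    ((A 0 0 - A 1 1) / 2, (A 1 0 + A 0 1) / 2), ?_⟩
  ext i j
  fin_cases i <;> fin_cases j <;> simp [rotationMatrix, reflectionMatrix] <;> field_simp <;> ring

end PlaneMatrices

/-- If `q ≡ 3 (mod 4)`, every 2×2 matrix over the finite field of order `q`
is a sum of exactly six orthogonal matrices. -/
theorem sum_of_six_orthogonal (q : ℕ) (F : Type*) [Field F] [Fintype F]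
    (hq : Fintype.card F = q) (hodd : Odd q) (hq4 : q % 4 = 3)
    (A : Matrix (Fin 2) (Fin 2) F) :
    ∃ B : Fin 6 → Matrix (Fin 2) (Fin 2) F,
      (∀ i, (B i)ᵀ * B i = 1) ∧ A = ∑ i, B i := by
  have h : ¬ IsSquare (-1 : F) := by
    rw [FiniteField.isSquare_neg_one_iff, hq]
    exact not_not.2 hq4
  suffices ∃ B₁ B₂ B₃ B₄ B₅ B₆ : Matrix (Fin 2) (Fin 2) F,
      (B₁ᵀ * B₁ = 1 ∧ B₂ᵀ * B₂ = 1 ∧ B₃ᵀ * B₃ = 1 ∧ B₄ᵀ * B₄ = 1 ∧ B₅ᵀ * B₅ = 1 ∧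
        B₆ᵀ * B₆ = 1) ∧ A = B₁ + B₂ + B₃ + B₄ + B₅ + B₆ by
    obtain ⟨B₁, B₂, B₃, B₄, B₅, B₆, ⟨h₁, h₂, h₃, h₄, h₅, h₆⟩, hA⟩ := this
    refine ⟨![B₁, B₂, B₃, B₄, B₅, B₆], fun i => ?_, ?_⟩
    · fin_cases i <;> assumption
    · rw [hA, Fin.sum_univ_six]
      rfl
  obtain ⟨z, w, rfl⟩ := exists_eq_rotationMatrix_add_reflectionMatrix
    (two_ne_zero_of_not_isSquare_neg_one h) A
  have hone : ((1, 0) : F × F).1 ^ 2 + ((1, 0) : F × F).2 ^ 2 = 1 := by simp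
  have hneg : ((-1, 0) : F × F).1 ^ 2 + ((-1, 0) : F × F).2 ^ 2 = 1 := by simp
  have hzero : (0 : F × F) = (1, 0) + (-1, 0) := by ext <;> simp
  have rot {p : F × F} := rotationMatrix_transpose_mul_self (p := p)
  have ref {p : F × F} := reflectionMatrix_transpose_mul_self (p := p)
  by_cases hz : z = 0
  · obtain ⟨a, b, c, d, ha, hb, hc, hd, rfl⟩ := exists_eq_add_add_add h w
    refine ⟨_, _, _, _, _, _, ⟨rot hone, rot hneg, ref ha, ref hb, ref hc, ref hd⟩, ?_⟩
    rw [hz, hzero]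
    simp only [rotationMatrix_add, reflectionMatrix_add]
    abel
  by_cases hw : w = 0
  · obtain ⟨a, b, c, d, ha, hb, hc, hd, rfl⟩ := exists_eq_add_add_add h z
    refine ⟨_, _, _, _, _, _, ⟨ref hone, ref hneg, rot ha, rot hb, rot hc, rot hd⟩, ?_⟩
    rw [hw, hzero]
    simp only [rotationMatrix_add, reflectionMatrix_add]
    abel
  obtain ⟨a, b, c, ha, hb, hc, rfl⟩ := exists_eq_add_add_of_ne_zero h hz
  obtain ⟨d, e, f, hd, he, hf, rfl⟩ := exists_eq_add_add_of_ne_zero h hw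
  refine ⟨_, _, _, _, _, _, ⟨rot ha, rot hb, rot hc, ref hd, ref he, ref hf⟩, ?_⟩
  simp only [rotationMatrix_add, reflectionMatrix_add]
  abel
end

section
/- Let q be an odd prime power and F the finite field of order q. If q ≡ 3 (mod 4), then every vector in F³ is the sum of three unit vectors; if q ≡ 1 (mod 4), then every vector in F³ is the sum of two unit vectors. -/
/-- In a finite field of odd order, `2` is nonzero. -/
theorem FiniteField.two_ne_zero_of_odd_card {F : Type*} [Field F] [Fintype F]
    (hodd : Fintype.card F % 2 = 1) : (2 : F) ≠ 0 :=
  Ring.two_ne_zero fun h ↦ by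
    have := FiniteField.even_card_iff_char_two.mp h
    omega

/-- In a finite field of odd order, every element is of the form `α s² + β t²` for given nonzero
`α` and `β`. -/
theorem FiniteField.exists_mul_sq_add_mul_sq {F : Type*} [Field F] [Fintype F]
    (hodd : Fintype.card F % 2 = 1) {α β : F} (hα : α ≠ 0) (hβ : β ≠ 0) (γ : F) :
    ∃ s t : F, α * s ^ 2 + β * t ^ 2 = γ := by
  open Polynomial in
  obtain ⟨s, t, h⟩ := FiniteField.exists_root_sum_quadratic
    (f := C α * X ^ 2 + C 0 * X + C 0) (g := C β * X ^ 2 + C 0 * X + C (-γ))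
    (degree_quadratic hα) (degree_quadratic hβ) hodd
  refine ⟨s, t, ?_⟩
  simp at h
  linear_combination h

/-- A vector `(a, b, c)` with `a² + b² + c² ≠ 0` and `a² + b² ≠ 0` is the sum of two unit
vectors. -/
theorem exists_two_units_of_sq_add_sq_ne_zero {F : Type*} [Field F] [Fintype F]
    (hodd : Fintype.card F % 2 = 1) {a b c : F} (hN : a ^ 2 + b ^ 2 + c ^ 2 ≠ 0)
    (hab : a ^ 2 + b ^ 2 ≠ 0) :
    ∃ x y z : F, x ^ 2 + y ^ 2 + z ^ 2 = 1 ∧ (a - x) ^ 2 + (b - y) ^ 2 + (c - z) ^ 2 = 1 := by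
  have h2 : (2 : F) ≠ 0 := FiniteField.two_ne_zero_of_odd_card hodd
  obtain ⟨s, t, h⟩ := FiniteField.exists_mul_sq_add_mul_sq hodd hab (mul_ne_zero hN hab)
    (1 - (a ^ 2 + b ^ 2 + c ^ 2) * (1 / 2) ^ 2)
  obtain ⟨k, hk⟩ : ∃ k : F, k = 1 / 2 := ⟨_, rfl⟩
  have hk2 : 2 * k = 1 := by rw [hk]; field_simp
  rw [← hk] at h
  refine ⟨k * a + s * b + t * (a * c), k * b - s * a + t * (b * c),
    k * c - t * (a ^ 2 + b ^ 2), ?_, ?_⟩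
  · linear_combination h
  · linear_combination h - (a ^ 2 + b ^ 2 + c ^ 2) * hk2

/-- A nonisotropic vector of `F³` is the sum of two unit vectors. -/
theorem exists_two_units_of_ne_zero {F : Type*} [Field F] [Fintype F]
    (hodd : Fintype.card F % 2 = 1) {a b c : F} (hN : a ^ 2 + b ^ 2 + c ^ 2 ≠ 0) :
    ∃ x y z : F, x ^ 2 + y ^ 2 + z ^ 2 = 1 ∧ (a - x) ^ 2 + (b - y) ^ 2 + (c - z) ^ 2 = 1 := by
  have h2 : (2 : F) ≠ 0 := FiniteField.two_ne_zero_of_odd_card hodd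
  by_cases hab : a ^ 2 + b ^ 2 = 0
  · by_cases hbc : b ^ 2 + c ^ 2 = 0
    · have hca : c ^ 2 + a ^ 2 ≠ 0 := fun hca ↦
        mul_ne_zero h2 hN (by linear_combination hab + hbc + hca)
      obtain ⟨z, x, y, h, h'⟩ := exists_two_units_of_sq_add_sq_ne_zero hodd
        (show c ^ 2 + a ^ 2 + b ^ 2 ≠ 0 by convert hN using 1; ring) hca
      exact ⟨x, y, z, by linear_combination h, by linear_combination h'⟩
    · obtain ⟨y, z, x, h, h'⟩ := exists_two_units_of_sq_add_sq_ne_zero hodd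
        (show b ^ 2 + c ^ 2 + a ^ 2 ≠ 0 by convert hN using 1; ring) hbc
      exact ⟨x, y, z, by linear_combination h, by linear_combination h'⟩
  · exact exists_two_units_of_sq_add_sq_ne_zero hodd hN hab

/-- If `-1` is a square, an isotropic vector `(a, b, c)` with `c ≠ 0` is the sum of two unit
vectors. -/
theorem exists_two_units_of_isotropic {F : Type*} [Field F] {i a b c : F} (hi : i ^ 2 = -1)
    (hN : a ^ 2 + b ^ 2 + c ^ 2 = 0) (hc : c ≠ 0) :
    ∃ x y z : F, x ^ 2 + y ^ 2 + z ^ 2 = 1 ∧ (a - x) ^ 2 + (b - y) ^ 2 + (c - z) ^ 2 = 1 := by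
  have hu : (i * b / c) ^ 2 + (-(i * a) / c) ^ 2 + 0 ^ 2 = 1 := by
    field_simp
    linear_combination (a ^ 2 + b ^ 2) * hi - hN
  refine ⟨i * b / c, -(i * a) / c, 0, hu, ?_⟩
  linear_combination hu + hN

/-- If `-1` is a square, every vector of `F³` is the sum of two unit vectors. -/
theorem exists_two_units_of_sq_eq_neg_one {F : Type*} [Field F] [Fintype F]
    (hodd : Fintype.card F % 2 = 1) {i : F} (hi : i ^ 2 = -1) (a b c : F) :
    ∃ x y z : F, x ^ 2 + y ^ 2 + z ^ 2 = 1 ∧ (a - x) ^ 2 + (b - y) ^ 2 + (c - z) ^ 2 = 1 := by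
  by_cases hN : a ^ 2 + b ^ 2 + c ^ 2 = 0
  · by_cases hc : c = 0
    · by_cases hb : b = 0
      · have ha : a = 0 := by simpa [hb, hc] using hN
        exact ⟨1, 0, 0, by simp, by simp [ha, hb, hc]⟩
      · obtain ⟨z, x, y, h, h'⟩ := exists_two_units_of_isotropic hi
          (show c ^ 2 + a ^ 2 + b ^ 2 = 0 by linear_combination hN) hb
        exact ⟨x, y, z, by linear_combination h, by linear_combination h'⟩
    · exact exists_two_units_of_isotropic hi hN hc
  · exact exists_two_units_of_ne_zero hodd hN

/-- Over a field of characteristic not two, every vector of `F³` differs from some unit vector by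
a nonisotropic vector. -/
theorem exists_unit_sub_nonisotropic {F : Type*} [Field F] (h2 : (2 : F) ≠ 0) (a b c : F) :
    ∃ x y z : F, x ^ 2 + y ^ 2 + z ^ 2 = 1 ∧ (a - x) ^ 2 + (b - y) ^ 2 + (c - z) ^ 2 ≠ 0 := by
  by_contra! H
  have h4 : (2 : F) * 2 ≠ 0 := mul_ne_zero h2 h2
  have ha : a = 0 := (mul_eq_zero_iff_left h4).mp (by
    linear_combination H (-1) 0 0 (by ring) - H 1 0 0 (by ring))
  have hb : b = 0 := (mul_eq_zero_iff_left h4).mp (by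
    linear_combination H 0 (-1) 0 (by ring) - H 0 1 0 (by ring))
  have hc : c = 0 := (mul_eq_zero_iff_left h4).mp (by
    linear_combination H 0 0 (-1) (by ring) - H 0 0 1 (by ring))
  simpa [ha, hb, hc] using H 1 0 0 (by ring)

/-- Every vector in `F³` is the sum of three unit vectors when `q ≡ 3 (mod 4)` and
the sum of two unit vectors when `q ≡ 1 (mod 4)`. -/
theorem vector_in_F3_sum_units (q : ℕ) (F : Type*) [Field F] [Fintype F]
    (hq : Fintype.card F = q) (hodd : Odd q) :
    (q % 4 = 3 → ∀ v : Fin 3 → F, ∃ u : Fin 3 → (Fin 3 → F),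
      (∀ i, (∑ j, u i j ^ 2) = 1) ∧ v = ∑ i, u i) ∧
    (q % 4 = 1 → ∀ v : Fin 3 → F, ∃ u w : Fin 3 → F,
      (∑ j, u j ^ 2) = 1 ∧ (∑ j, w j ^ 2) = 1 ∧ v = u + w) := by
  subst hq
  have hcard : Fintype.card F % 2 = 1 := Nat.odd_iff.mp hodd
  have h2 : (2 : F) ≠ 0 := FiniteField.two_ne_zero_of_odd_card hcard
  refine ⟨fun _ v ↦ ?_, fun h1 v ↦ ?_⟩
  · obtain ⟨x, y, z, h, hN⟩ := exists_unit_sub_nonisotropic h2 (v 0) (v 1) (v 2)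
    obtain ⟨x', y', z', h', h''⟩ := exists_two_units_of_ne_zero hcard hN
    refine ⟨![![x, y, z], ![x', y', z'], ![v 0 - x - x', v 1 - y - y', v 2 - z - z']], ?_, ?_⟩
    · intro i
      fin_cases i <;> simpa [Fin.sum_univ_three]
    · ext j
      fin_cases j <;> simp [Fin.sum_univ_three]
  · obtain ⟨i, hi⟩ := FiniteField.isSquare_neg_one_iff.mpr (show Fintype.card F % 4 ≠ 3 by omega)
    obtain ⟨x, y, z, h, h'⟩ := exists_two_units_of_sq_eq_neg_one hcard
      (show i ^ 2 = -1 by rw [hi, sq]) (v 0) (v 1) (v 2)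
    refine ⟨![x, y, z], ![v 0 - x, v 1 - y, v 2 - z], ?_, ?_, ?_⟩
    · simpa [Fin.sum_univ_three]
    · simpa [Fin.sum_univ_three]
    · ext j
      fin_cases j <;> simp
end

section
/- Let q be an odd prime power and F the finite field of order q. Let U = {L ∈ F : every vector in F² of length L is the sum of two unit vectors}. Then |U| = (q + 3)/2 if q ≡ 3 (mod 4), and |U| = (q − 1)/2 if q ≡ 1 (mod 4). -/
/-- A finite field of odd order `q` has `(q + 1) / 2` squares, counting zero. -/
theorem two_mul_card_squares (F : Type*) [Field F] [Fintype F] (hF : ringChar F ≠ 2) :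
    2 * Set.ncard {s : F | IsSquare s} = Fintype.card F + 1 := by
  classical
  have hterm (s : F) : quadraticChar F s + 1 + (if s = 0 then 1 else 0) =
      if IsSquare s then (2 : ℤ) else 0 := by
    by_cases h0 : s = 0
    · simp [h0]
    by_cases hs : IsSquare s
    · simp [h0, hs, (quadraticChar_one_iff_isSquare h0).2 hs]
    · simp [h0, hs, quadraticChar_neg_one_iff_not_isSquare.2 hs]
  have hsum := Finset.sum_congr (rfl : (Finset.univ : Finset F) = Finset.univ) fun s _ => hterm s
  rw [Finset.sum_add_distrib, Finset.sum_add_distrib, quadraticChar_sum_zero hF,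
    Finset.sum_ite_eq' Finset.univ, if_pos (Finset.mem_univ _), ← Finset.sum_filter] at hsum
  simp only [Finset.sum_const, Finset.card_univ, nsmul_eq_mul, mul_one, zero_add] at hsum
  have hcard : Set.ncard {s : F | IsSquare s} = (Finset.univ.filter fun s : F => IsSquare s).card := by
    rw [← Set.ncard_coe_finset]
    simp
  rw [hcard]
  zify
  linarith

/-- A vector of nonzero length `L` is a sum of two unit vectors iff `4 / L - 1` is a square. -/
theorem exists_unit_add_unit_iff {F : Type*} [Field F] (h2 : (2 : F) ≠ 0)
    {a b L : F} (hL : L ≠ 0) (hab : a ^ 2 + b ^ 2 = L) :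
    (∃ u w : Fin 2 → F, (∑ i, u i ^ 2) = 1 ∧ (∑ i, w i ^ 2) = 1 ∧ ![a, b] = u + w) ↔
      IsSquare (4 / L - 1) := by
  simp only [Fin.sum_univ_two]
  constructor
  · rintro ⟨u, w, hu, hw, h⟩
    have ha : w 0 = a - u 0 := by
      have := congrFun h 0
      simp only [Matrix.cons_val_zero, Pi.add_apply] at this
      rw [this]; ring
    have hb : w 1 = b - u 1 := by
      have := congrFun h 1
      simp only [Matrix.cons_val_one, Matrix.cons_val_zero, Pi.add_apply] at this
      rw [this]; ring
    rw [ha, hb] at hw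
    have hdot : 2 * (a * u 0 + b * u 1) = L := by linear_combination hu - hw + hab
    refine ⟨2 * (a * u 1 - b * u 0) / L, ?_⟩
    field_simp
    linear_combination (-4 * L) * hu - 4 * (u 0 ^ 2 + u 1 ^ 2) * hab
      + (2 * (a * u 0 + b * u 1) + L) * hdot
  · rintro ⟨r, hr⟩
    have hr' : 4 - L = L * r ^ 2 := by
      field_simp at hr
      linear_combination hr
    have h4 : (4 : F) ≠ 0 := by
      have : (4 : F) = 2 * 2 := by norm_num
      rw [this]; exact mul_ne_zero h2 h2
    refine ⟨![(a - r * b) / 2, (b + r * a) / 2], ![(a + r * b) / 2, (b - r * a) / 2], ?_, ?_, ?_⟩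
    · simp only [Matrix.cons_val_zero, Matrix.cons_val_one]
      field_simp
      linear_combination (1 + r ^ 2) * hab - hr'
    · simp only [Matrix.cons_val_zero, Matrix.cons_val_one]
      field_simp
      linear_combination (1 + r ^ 2) * hab - hr'
    · ext i
      fin_cases i <;> simp <;> field_simp <;> ring

open Polynomial in
/-- Every element of a finite field of odd order is a sum of two squares. -/
theorem exists_sq_add_sq_eq_of_odd_card {F : Type*} [Field F] [Fintype F]
    (hodd : Odd (Fintype.card F)) (L : F) : ∃ a b : F, a ^ 2 + b ^ 2 = L := by
  obtain ⟨a, b, hab⟩ := FiniteField.exists_root_sum_quadratic (f := (X ^ 2 : F[X]))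
    (g := X ^ 2 - C L) (degree_X_pow 2) (degree_X_pow_sub_C (by decide) _) (Nat.odd_iff.1 hodd)
  refine ⟨a, b, ?_⟩
  simp only [eval_C, eval_X, eval_pow, eval_sub] at hab
  linear_combination hab

/-- A nonzero length `L` is good iff `4 / L - 1` is a square. -/
theorem forall_exists_unit_add_unit_iff {F : Type*} [Field F] [Fintype F]
    (hodd : Odd (Fintype.card F)) (h2 : (2 : F) ≠ 0)
    {L : F} (hL : L ≠ 0) :
    (∀ v : Fin 2 → F, (∑ i, v i ^ 2) = L →
      ∃ u w : Fin 2 → F, (∑ i, u i ^ 2) = 1 ∧ (∑ i, w i ^ 2) = 1 ∧ v = u + w) ↔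
      IsSquare (4 / L - 1) := by
  constructor
  · intro h
    obtain ⟨a, b, hab⟩ := exists_sq_add_sq_eq_of_odd_card hodd L
    exact (exists_unit_add_unit_iff h2 hL hab).1 (h ![a, b] (by simpa using hab))
  · intro h v hv
    have hv' : v = ![v 0, v 1] := by ext i; fin_cases i <;> rfl
    rw [Fin.sum_univ_two] at hv
    rw [hv']
    exact (exists_unit_add_unit_iff h2 hL hv).2 h

/-- The length `0` is good iff `-1` is not a square. -/
theorem zero_forall_exists_unit_add_unit_iff {F : Type*} [Field F] (h2 : (2 : F) ≠ 0) :
    (∀ v : Fin 2 → F, (∑ i, v i ^ 2) = 0 →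
      ∃ u w : Fin 2 → F, (∑ i, u i ^ 2) = 1 ∧ (∑ i, w i ^ 2) = 1 ∧ v = u + w) ↔
      ¬ IsSquare (-1 : F) := by
  simp only [Fin.sum_univ_two]
  constructor
  · rintro h ⟨r, hr⟩
    obtain ⟨u, w, hu, hw, huw⟩ := h ![1, r] (by simp; linear_combination -hr)
    have h0 : 1 = u 0 + w 0 := by simpa using congrFun huw 0
    have h1 : r = u 1 + w 1 := by simpa using congrFun huw 1
    have hw0 : w 0 = 1 - u 0 := by rw [h0]; ring
    have hw1 : w 1 = r - u 1 := by
      rw [h1]; ring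
    rw [hw0, hw1] at hw
    have hdot : u 0 + r * u 1 = 0 := by
      have : 2 * (u 0 + r * u 1) = 0 := by linear_combination hu - hw - hr
      exact (mul_eq_zero.1 this).resolve_left h2
    have : (1 : F) = 0 := by
      linear_combination -hu + (u 0 - r * u 1) * hdot - u 1 ^ 2 * hr
    exact one_ne_zero this
  · intro h v hv
    have hv1 : v 1 = 0 := by
      by_contra hne
      refine h ⟨v 0 / v 1, ?_⟩
      field_simp
      linear_combination -hv
    have hv0 : v 0 = 0 := by simpa [hv1] using hv
    refine ⟨![1, 0], ![-1, 0], by simp, by simp, ?_⟩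
    ext i
    fin_cases i <;> simp [hv0, hv1]

theorem injective_four_div_sub_one {F : Type*} [Field F] (h2 : (2 : F) ≠ 0) :
    Function.Injective fun L : F => 4 / L - 1 := by
  have h4 : (4 : F) ≠ 0 := by
    have : (4 : F) = 2 * 2 := by norm_num
    rw [this]; exact mul_ne_zero h2 h2
  intro x y h
  simpa [div_eq_mul_inv, h4] using h

/-- Let `U` be the set of lengths `L` such that every vector in `F²` of length `L`
is the sum of two unit vectors. Then `|U| = (q+3)/2` if `q ≡ 3 (mod 4)` and
`|U| = (q-1)/2` if `q ≡ 1 (mod 4)`. -/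
theorem card_of_good_lengths (q : ℕ) (F : Type*) [Field F] [Fintype F]
    (hq : Fintype.card F = q) (hodd : Odd q) (U : Set F)
    (hU : U = {L : F | ∀ v : Fin 2 → F, (∑ i, v i ^ 2) = L →
      ∃ u w : Fin 2 → F, (∑ i, u i ^ 2) = 1 ∧ (∑ i, w i ^ 2) = 1 ∧ v = u + w}) :
    (q % 4 = 3 → Nat.card U = (q + 3) / 2) ∧
    (q % 4 = 1 → Nat.card U = (q - 1) / 2) := by
  subst hq
  have hF : ringChar F ≠ 2 := fun h => by
    have := FiniteField.even_card_of_char_two h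
    have := Nat.odd_iff.1 hodd
    omega
  have h2 : (2 : F) ≠ 0 := Ring.two_ne_zero hF
  have hcard := two_mul_card_squares F hF
  have hinj := injective_four_div_sub_one h2
  have hbij := Finite.injective_iff_bijective.1 hinj
  have hpre (T : Set F) : Set.ncard ((fun L : F => 4 / L - 1) ⁻¹' T) = T.ncard :=
    Set.ncard_preimage_of_injective_subset_range hinj (by simp [hbij.2.range_eq])
  have hval (L : F) : 4 / L - 1 = -1 ↔ L = 0 := by
    rw [← hinj.eq_iff (a := L) (b := 0)]
    simp
  have hmem (L : F) (hL : L ≠ 0) : L ∈ U ↔ IsSquare (4 / L - 1) := by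
    rw [hU]
    exact forall_exists_unit_add_unit_iff hodd h2 hL
  have hzero : 0 ∈ U ↔ ¬ IsSquare (-1 : F) := by
    rw [hU]
    exact zero_forall_exists_unit_add_unit_iff h2
  rw [Nat.card_coe_set_eq]
  constructor
  · intro h
    have hns : ¬ IsSquare (-1 : F) := fun hs => FiniteField.isSquare_neg_one_iff.1 hs h
    have hUT : U = (fun L : F => 4 / L - 1) ⁻¹' insert (-1) {s : F | IsSquare s} := by
      ext L
      by_cases hL : L = 0
      · simp [hL, hzero, hns]
      · simp [hmem L hL, hval, hL]
    rw [hUT, hpre, Set.ncard_insert_of_notMem (s := {s : F | IsSquare s}) hns]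
    omega
  · intro h
    have hs : IsSquare (-1 : F) := FiniteField.isSquare_neg_one_iff.2 (by omega)
    have hUT : U = (fun L : F => 4 / L - 1) ⁻¹' ({s : F | IsSquare s} \ {-1}) := by
      ext L
      by_cases hL : L = 0
      · simp [hL, hzero, hs]
      · simp [hmem L hL, hval, hL]
    rw [hUT, hpre, Set.ncard_sdiff_singleton_of_mem (s := {s : F | IsSquare s}) hs]
    omega
end
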